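/- arXiv:2104.07110 — 2 statements merged into one kernel-verified Lean document; each statement's English description precedes it below -/
import Mathlib

section
/- Let X be a real Banach space, let T : [0,∞) → B(X) be a strongly continuous semigroup with generator A, and let ω ∈ ℝ, M ≥ 0 satisfy ‖T(t)‖ ≤ M e^{ωt} for all t ≥ 0. Let a, b ∈ ℝ with a > ω, and let Q be the (bounded, everywhere defined) inverse of the bijective operator Δ := A² − 2a A + (a² + b²)·Id : D(A²) → X. Then for every x ∈ X one has Q x ∈ D(A) and A(Q x) = − ∫_0^∞ e^{−a t} (cos(b t) − a t sinc(b t)) · T(t)x dt (Bochner integral). -/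
open MeasureTheory Filter Set Quaternion

noncomputable section

/-- The unnormalized sinc function. -/
def sinc (r : ℝ) : ℝ := if r = 0 then 1 else Real.sin r / r

/-- `T : [0,∞) → B(X)` is a strongly continuous semigroup. -/
def IsSCSemigroup {X : Type*} [NormedAddCommGroup X] [NormedSpace ℝ X]
    (T : ℝ → X →L[ℝ] X) : Prop :=
  T 0 = 1 ∧ (∀ s t : ℝ, 0 ≤ s → 0 ≤ t → T (t + s) = (T t).comp (T s)) ∧
    ∀ x : X, ContinuousOn (fun t => T t x) (Set.Ici 0)

/-- The domain of the generator of `T`. -/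
def genDomain {X : Type*} [NormedAddCommGroup X] [NormedSpace ℝ X]
    (T : ℝ → X →L[ℝ] X) : Set X :=
  {x | ∃ y : X, Tendsto (fun h : ℝ => (1 / h) • (T h x - x)) (nhdsWithin 0 (Set.Ioi 0)) (nhds y)}

/-- `A` is the generator of `T` (its values outside `genDomain T` are irrelevant). -/
def IsGenerator {X : Type*} [NormedAddCommGroup X] [NormedSpace ℝ X]
    (T : ℝ → X →L[ℝ] X) (A : X → X) : Prop :=
  ∀ x ∈ genDomain T,
    Tendsto (fun h : ℝ => (1 / h) • (T h x - x)) (nhdsWithin 0 (Set.Ioi 0)) (nhds (A x))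

/-- `iterDomain T A k` is `D(A^k)`. -/
def iterDomain {X : Type*} [NormedAddCommGroup X] [NormedSpace ℝ X]
    (T : ℝ → X →L[ℝ] X) (A : X → X) : ℕ → Set X
  | 0 => Set.univ
  | k + 1 => {x | x ∈ iterDomain T A k ∧ A^[k] x ∈ genDomain T}

theorem hasDerivAt_mul_sinc (b t : ℝ) :
    HasDerivAt (fun u => u * sinc (b * u)) (Real.cos (b * t)) t := by
  by_cases hb : b = 0
  · subst hb
    simpa [sinc] using hasDerivAt_id' t
  · have h : (fun u => u * sinc (b * u)) = fun u => Real.sin (b * u) / b := by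
      funext u
      by_cases hu : u = 0
      · simp [hu]
      · simp only [sinc, mul_eq_zero, hb, hu, or_self, if_false]
        field_simp
    rw [h]
    refine ((((hasDerivAt_id' t).const_mul b).sin).div_const b).congr_deriv ?_
    rw [mul_one, mul_div_cancel_right₀ _ hb]

theorem sq_mul_mul_sinc (b t : ℝ) : b ^ 2 * (t * sinc (b * t)) = b * Real.sin (b * t) := by
  by_cases h : b * t = 0
  · rw [h, Real.sin_zero, mul_zero, show b ^ 2 * (t * sinc 0) = b * (b * t) * sinc 0 by ring, h]
    simp
  · rw [sinc, if_neg h, show b ^ 2 * (t * (Real.sin (b * t) / (b * t))) =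
      b * ((b * t) * (Real.sin (b * t) / (b * t))) by ring, mul_div_cancel₀ _ h]

theorem abs_sinc_le_one (r : ℝ) : |sinc r| ≤ 1 :=
  Real.abs_sinc_le_one r

theorem hasDerivAt_exp_mul_mul_sinc (a b t : ℝ) :
    HasDerivAt (fun u => Real.exp (-(a * u)) * (u * sinc (b * u)))
      (Real.exp (-(a * t)) * (Real.cos (b * t) - a * t * sinc (b * t))) t := by
  have h := (((hasDerivAt_id t).const_mul a).neg.exp).mul (hasDerivAt_mul_sinc b t)
  refine h.congr_deriv ?_
  simp only [id, Pi.neg_apply]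
  ring

theorem hasDerivAt_exp_mul_cos_sub_sinc (a b t : ℝ) :
    HasDerivAt (fun u => Real.exp (-(a * u)) * (Real.cos (b * u) - a * u * sinc (b * u)))
      (-(2 * a) * (Real.exp (-(a * t)) * (Real.cos (b * t) - a * t * sinc (b * t)))
        - (a ^ 2 + b ^ 2) * (Real.exp (-(a * t)) * (t * sinc (b * t)))) t := by
  have hs := (hasDerivAt_mul_sinc b t).const_mul a
  simp only [← mul_assoc] at hs
  have h := (((hasDerivAt_id t).const_mul a).neg.exp).mul
    ((((hasDerivAt_id t).const_mul b).cos).sub hs)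
  refine h.congr_deriv ?_
  simp only [id, Pi.neg_apply, Pi.sub_apply]
  linear_combination (Real.exp (-(a * t))) * sq_mul_mul_sinc b t

section Semigroup

variable {X : Type*} [NormedAddCommGroup X] [NormedSpace ℝ X] {T : ℝ → X →L[ℝ] X}

theorem IsSCSemigroup.hasDerivWithinAt (hT : IsSCSemigroup T) {x y : X}
    (hxy : Tendsto (fun h : ℝ => (1 / h) • (T h x - x)) (nhdsWithin 0 (Ioi 0)) (nhds y))
    {t : ℝ} (ht : 0 ≤ t) :
    HasDerivWithinAt (fun u => T u x) (T t y) (Ioi t) t := by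
  have h0 : HasDerivWithinAt (fun u => T u x) y (Ioi 0) (t - t) := by
    rw [sub_self, hasDerivWithinAt_iff_tendsto_slope' self_notMem_Ioi]
    refine hxy.congr fun h => ?_
    simp [slope, hT.1]
  have h1 : HasDerivWithinAt (fun u => T (u - t) x) y (Ioi t) t := by
    have hsub : HasDerivWithinAt (fun u => u - t) 1 (Ioi t) t :=
      (hasDerivWithinAt_id t (Ioi t)).sub_const t
    have hmaps : MapsTo (fun u => u - t) (Ioi t) (Ioi 0) := fun u hu => sub_pos.2 (mem_Ioi.1 hu)
    simpa [Function.comp_def] using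
      HasDerivWithinAt.scomp (h := fun u => u - t) t h0 hsub hmaps
  have h2 : HasDerivWithinAt (fun u => T t (T (u - t) x)) (T t y) (Ioi t) t :=
    (T t).hasFDerivAt.comp_hasDerivWithinAt t h1
  have key : ∀ u, t ≤ u → T u x = T t (T (u - t) x) := fun u hu => by
    have := hT.2.1 (u - t) t (sub_nonneg.2 hu) ht
    rw [add_sub_cancel] at this
    simp [this]
  exact h2.congr (fun u hu => key u (le_of_lt hu)) (key t le_rfl)

theorem exists_norm_smul_le_exp {ω M a C : ℝ}
    (hbound : ∀ t : ℝ, 0 ≤ t → ‖T t‖ ≤ M * Real.exp (ω * t)) (ha : ω < a) (hC : 0 ≤ C)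
    {p : ℝ → ℝ} (hp : ∀ t, 0 ≤ t → |p t| ≤ Real.exp (-(a * t)) * (1 + C * t)) (x : X) :
    ∃ δ > 0, ∃ K : ℝ, ∀ t, 0 ≤ t → ‖p t • T t x‖ ≤ K * Real.exp (-δ * t) := by
  have hδ : 0 < (a - ω) / 2 := by linarith
  obtain ⟨δ, hδe⟩ : ∃ δ, δ = (a - ω) / 2 := ⟨_, rfl⟩
  rw [← hδe] at hδ
  refine ⟨δ, hδ, (1 + C / δ) * M * ‖x‖, fun t ht => ?_⟩
  have h1 : 1 + C * t ≤ (1 + C / δ) * Real.exp (δ * t) := by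
    have e1 : δ * t ≤ Real.exp (δ * t) := by linarith [Real.add_one_le_exp (δ * t)]
    have e2 : 1 ≤ Real.exp (δ * t) := Real.one_le_exp (by positivity)
    have e3 : C * t = C / δ * (δ * t) := by field_simp
    have e4 := mul_le_mul_of_nonneg_left e1 (show 0 ≤ C / δ by positivity)
    linarith
  have h2 : |p t| ≤ Real.exp (-(a * t)) * ((1 + C / δ) * Real.exp (δ * t)) :=
    (hp t ht).trans (by gcongr)
  have h3 : ‖T t x‖ ≤ M * Real.exp (ω * t) * ‖x‖ :=
    (T t).le_of_opNorm_le (hbound t ht) x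
  calc ‖p t • T t x‖ = |p t| * ‖T t x‖ := by rw [norm_smul, Real.norm_eq_abs]
    _ ≤ Real.exp (-(a * t)) * ((1 + C / δ) * Real.exp (δ * t)) *
        (M * Real.exp (ω * t) * ‖x‖) := by gcongr
    _ = (1 + C / δ) * M * ‖x‖ *
        (Real.exp (-(a * t)) * Real.exp (δ * t) * Real.exp (ω * t)) := by ring
    _ = (1 + C / δ) * M * ‖x‖ * Real.exp (-δ * t) := by
        rw [← Real.exp_add, ← Real.exp_add]
        congr 2
        rw [hδe]
        ring

theorem tendsto_smul_semigroup_atTop {ω M a C : ℝ}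
    (hbound : ∀ t : ℝ, 0 ≤ t → ‖T t‖ ≤ M * Real.exp (ω * t)) (ha : ω < a) (hC : 0 ≤ C)
    {p : ℝ → ℝ} (hp : ∀ t, 0 ≤ t → |p t| ≤ Real.exp (-(a * t)) * (1 + C * t)) (x : X) :
    Tendsto (fun t => p t • T t x) atTop (nhds 0) := by
  obtain ⟨δ, hδ, K, hK⟩ := exists_norm_smul_le_exp hbound ha hC hp x
  refine squeeze_zero_norm' ((eventually_ge_atTop 0).mono hK) ?_
  have : Tendsto (fun t : ℝ => -δ * t) atTop atBot :=
    tendsto_id.const_mul_atTop_of_neg (neg_lt_zero.2 hδ)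
  simpa using (Real.tendsto_exp_atBot.comp this).const_mul K

theorem IsSCSemigroup.integrableOn_smul (hT : IsSCSemigroup T) {ω M a C : ℝ}
    (hbound : ∀ t : ℝ, 0 ≤ t → ‖T t‖ ≤ M * Real.exp (ω * t)) (ha : ω < a) (hC : 0 ≤ C)
    {p : ℝ → ℝ} (hp : ∀ t, 0 ≤ t → |p t| ≤ Real.exp (-(a * t)) * (1 + C * t))
    (hpc : Continuous p) (x : X) :
    IntegrableOn (fun t => p t • T t x) (Ioi 0) := by
  obtain ⟨δ, hδ, K, hK⟩ := exists_norm_smul_le_exp hbound ha hC hp x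
  refine Integrable.mono' ((exp_neg_integrableOn_Ioi 0 hδ).const_mul K) ?_ ?_
  · exact ((hpc.continuousOn.smul (hT.2.2 x)).mono Ioi_subset_Ici_self).aestronglyMeasurable
      measurableSet_Ioi
  · exact (ae_restrict_mem measurableSet_Ioi).mono fun t ht => hK t (le_of_lt ht)

end Semigroup

theorem stmt_3 {X : Type*} [NormedAddCommGroup X] [NormedSpace ℝ X] [CompleteSpace X]
    (T : ℝ → X →L[ℝ] X) (hT : IsSCSemigroup T) (A : X → X) (hA : IsGenerator T A)
    (ω M : ℝ) (hM : 0 ≤ M) (hbound : ∀ t : ℝ, 0 ≤ t → ‖T t‖ ≤ M * Real.exp (ω * t))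
    (a b : ℝ) (ha : ω < a) (Q : X →L[ℝ] X)
    (hQleft : ∀ x ∈ iterDomain T A 2,
      Q (A^[2] x - (2 * a) • A x + (a ^ 2 + b ^ 2) • x) = x)
    (hQright : ∀ x : X, Q x ∈ iterDomain T A 2 ∧
      A^[2] (Q x) - (2 * a) • A (Q x) + (a ^ 2 + b ^ 2) • Q x = x) :
    ∀ x : X, Q x ∈ genDomain T ∧
      A (Q x) = -∫ t in Set.Ioi (0 : ℝ),
        (Real.exp (-(a * t)) * (Real.cos (b * t) - a * t * sinc (b * t))) • T t x := by
  intro x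
  obtain ⟨⟨⟨-, h0⟩, h1⟩, hx⟩ := hQright x
  obtain ⟨y, hy⟩ : ∃ y, y = Q x := ⟨_, rfl⟩
  rw [← hy] at h0 h1 hx ⊢
  simp only [Function.iterate_succ, Function.iterate_zero, Function.comp_apply, id] at h0 h1 hx
  refine ⟨h0, ?_⟩
  set g : ℝ → ℝ := fun t => Real.exp (-(a * t)) * (t * sinc (b * t)) with hg
  set k : ℝ → ℝ := fun t => Real.exp (-(a * t)) * (Real.cos (b * t) - a * t * sinc (b * t)) with hk
  have hgd : ∀ t, HasDerivAt g (k t) t := hasDerivAt_exp_mul_mul_sinc a b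
  have hkd : ∀ t, HasDerivAt k (-(2 * a) * k t - (a ^ 2 + b ^ 2) * g t) t :=
    hasDerivAt_exp_mul_cos_sub_sinc a b
  have hgc : Continuous g := continuous_iff_continuousAt.2 fun t => (hgd t).continuousAt
  have hkc : Continuous k := continuous_iff_continuousAt.2 fun t => (hkd t).continuousAt
  have hs : ∀ t, 0 ≤ t → |t * sinc (b * t)| ≤ t := fun t ht => by
    rw [abs_mul, abs_of_nonneg ht]
    exact mul_le_of_le_one_right ht (abs_sinc_le_one _)
  have hgb : ∀ t, 0 ≤ t → |g t| ≤ Real.exp (-(a * t)) * (1 + 1 * t) := fun t ht => by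
    rw [hg, abs_mul, Real.abs_exp]
    gcongr
    linarith [hs t ht]
  have hkb : ∀ t, 0 ≤ t → |k t| ≤ Real.exp (-(a * t)) * (1 + |a| * t) := fun t ht => by
    rw [hk, abs_mul, Real.abs_exp]
    gcongr
    refine (abs_sub _ _).trans (add_le_add (Real.abs_cos_le_one _) ?_)
    rw [mul_assoc, abs_mul]
    exact mul_le_mul_of_nonneg_left (hs t ht) (abs_nonneg a)
  have hint := hT.integrableOn_smul hbound ha (abs_nonneg a) hkb hkc x
  set F : ℝ → X := fun t => k t • T t (A y) + (a ^ 2 + b ^ 2) • (g t • T t y) with hF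
  have hFc : ContinuousOn F (Ici 0) :=
    (hkc.continuousOn.smul (hT.2.2 _)).add
      ((hgc.continuousOn.smul (hT.2.2 _)).const_smul (a ^ 2 + b ^ 2))
  have hFd : ∀ t, 0 ≤ t → HasDerivWithinAt F (k t • T t x) (Ioi t) t := fun t ht => by
    have d0 := hT.hasDerivWithinAt (hA _ h0) ht
    have d1 := hT.hasDerivWithinAt (hA _ h1) ht
    refine (((hkd t).hasDerivWithinAt.smul d1).add
      (((hgd t).hasDerivWithinAt.smul d0).const_smul (a ^ 2 + b ^ 2))).congr_deriv ?_
    rw [← hx]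
    simp only [map_add, map_sub, map_smul]
    module
  have hFlim : Tendsto F atTop (nhds 0) := by
    simpa using (tendsto_smul_semigroup_atTop hbound ha (abs_nonneg a) hkb (A y)).add
      ((tendsto_smul_semigroup_atTop hbound ha zero_le_one hgb y).const_smul (a ^ 2 + b ^ 2))
  have hF0 : F 0 = A y := by simp [hF, hk, hg, hT.1]
  have hftc : ∀ R : ℝ, 0 ≤ R → ∫ t in (0 : ℝ)..R, k t • T t x = F R - F 0 := fun R hR =>
    intervalIntegral.integral_eq_sub_of_hasDeriv_right_of_le hR
      (hFc.mono Icc_subset_Ici_self) (fun t ht => hFd t ht.1.le)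
      ((intervalIntegrable_iff_integrableOn_Ioc_of_le hR).2 (hint.mono_set Ioc_subset_Ioi_self))
  have hlim := intervalIntegral_tendsto_integral_Ioi 0 hint tendsto_id
  have hlim' : Tendsto (fun R : ℝ => ∫ t in (0 : ℝ)..R, k t • T t x) atTop (nhds (0 - F 0)) :=
    (hFlim.sub_const (F 0)).congr' ((eventually_ge_atTop 0).mono fun R hR => (hftc R hR).symm)
  rw [tendsto_nhds_unique hlim hlim', hF0, zero_sub, neg_neg]
end
end

section
/- Let X be a real Banach space, let T : [0,∞) → B(X) be a strongly continuous semigroup with generator A, and let g : [0,∞) → ℝ be of class C² with g(0) = 0, g'(0) = 1, and ∫_0^∞ ‖T(t)‖ |g^{(k)}(t)| dt < ∞ for k = 0, 1, 2. Define L(f)x := ∫_0^∞ f(t) · T(t)x dt for such integrable f. Then for all a, b ∈ ℝ and every x ∈ X one has L(g)x ∈ D(A²) and (A² − 2a A + (a² + b²)·Id)(L(g)x) = x + L(g'' + 2a g' + (a² + b²)g)x. -/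
open MeasureTheory Filter Set Quaternion

noncomputable section

section Laplace

variable {X : Type*} [NormedAddCommGroup X] [NormedSpace ℝ X] {T : ℝ → X →L[ℝ] X}

namespace IsSCSemigroup

theorem integrableOn_smul_s15 (hT : IsSCSemigroup T) {f : ℝ → ℝ} (hf : ContinuousOn f (Ici 0))
    (hfi : IntegrableOn (fun t => ‖T t‖ * |f t|) (Ioi 0)) (x : X) :
    IntegrableOn (fun t => f t • T t x) (Ioi 0) := by
  refine (hfi.mul_const ‖x‖).mono' ?_ (Eventually.of_forall fun t => ?_)
  · exact ((hf.smul (hT.2.2 x)).mono Ioi_subset_Ici_self).aestronglyMeasurable measurableSet_Ioi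
  · rw [norm_smul, Real.norm_eq_abs, mul_comm ‖T t‖, mul_assoc]
    gcongr
    exact (T t).le_opNorm x

/-- The operator `x ↦ ∫ f(t) T(t)x dt`. -/
def laplaceCLM (hT : IsSCSemigroup T) {f : ℝ → ℝ} (hf : ContinuousOn f (Ici 0))
    (hfi : IntegrableOn (fun t => ‖T t‖ * |f t|) (Ioi 0)) : X →L[ℝ] X :=
  LinearMap.mkContinuous
    { toFun := fun x => ∫ t in Ioi (0 : ℝ), f t • T t x
      map_add' := fun x y => by
        simp only [map_add, smul_add]
        exact integral_add (hT.integrableOn_smul_s15 hf hfi x) (hT.integrableOn_smul_s15 hf hfi y)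
      map_smul' := fun c x => by
        simp only [map_smul, RingHom.id_apply]
        rw [← integral_smul]
        exact integral_congr_ae (Eventually.of_forall fun t => smul_comm _ _ _) }
    (∫ t in Ioi (0 : ℝ), ‖T t‖ * |f t|) fun x => by
      rw [← integral_mul_const]
      refine norm_integral_le_of_norm_le (hfi.mul_const ‖x‖) (Eventually.of_forall fun t => ?_)
      rw [norm_smul, Real.norm_eq_abs, mul_comm ‖T t‖, mul_assoc]
      gcongr
      exact (T t).le_opNorm x

theorem laplaceCLM_apply (hT : IsSCSemigroup T) {f : ℝ → ℝ} (hf : ContinuousOn f (Ici 0))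
    (hfi : IntegrableOn (fun t => ‖T t‖ * |f t|) (Ioi 0)) (x : X) :
    hT.laplaceCLM hf hfi x = ∫ t in Ioi (0 : ℝ), f t • T t x := rfl

theorem apply_add (hT : IsSCSemigroup T) {s t : ℝ} (hs : 0 ≤ s) (ht : 0 ≤ t) (x : X) :
    T (t + s) x = T t (T s x) := by
  rw [hT.2.1 s t hs ht]; rfl

theorem continuous_orbit (hT : IsSCSemigroup T) (x : X) :
    Continuous fun t => T (max t 0) x :=
  (hT.2.2 x).comp_continuous (by fun_prop) fun t => le_max_right t 0

variable [CompleteSpace X]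

theorem laplaceCLM_comm (hT : IsSCSemigroup T) {f : ℝ → ℝ} (hf : ContinuousOn f (Ici 0))
    (hfi : IntegrableOn (fun t => ‖T t‖ * |f t|) (Ioi 0)) {h : ℝ} (hh : 0 ≤ h) (x : X) :
    T h (hT.laplaceCLM hf hfi x) = hT.laplaceCLM hf hfi (T h x) := by
  rw [laplaceCLM_apply, laplaceCLM_apply,
    ← (T h).integral_comp_comm (hT.integrableOn_smul_s15 hf hfi x)]
  refine setIntegral_congr_fun measurableSet_Ioi fun t (ht : 0 < t) => ?_
  simp only [map_smul]
  rw [← hT.apply_add ht.le hh, ← hT.apply_add hh ht.le, add_comm]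

theorem hasDerivAt_primitive (hT : IsSCSemigroup T) (x : X) (t : ℝ) :
    HasDerivAt (fun u => ∫ r in (0 : ℝ)..u, T (max r 0) x) (T (max t 0) x) t :=
  (hT.continuous_orbit x).integral_hasStrictDerivAt 0 t |>.hasDerivAt

theorem apply_primitive (hT : IsSCSemigroup T) (x : X) {h s : ℝ} (hh : 0 ≤ h) (hs : 0 ≤ s) :
    T s (∫ r in (0 : ℝ)..h, T (max r 0) x) =
      (∫ r in (0 : ℝ)..(s + h), T (max r 0) x) - ∫ r in (0 : ℝ)..s, T (max r 0) x := by
  have hi := fun a b => (hT.continuous_orbit x).intervalIntegrable (μ := volume) a b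
  rw [intervalIntegral.integral_interval_sub_left (hi _ _) (hi _ _),
    ← (T s).intervalIntegral_comp_comm (hi _ _)]
  have := intervalIntegral.integral_comp_add_left (a := 0) (b := h)
    (fun r => T (max r 0) x) s
  rw [add_zero] at this
  rw [← this]
  refine intervalIntegral.integral_congr fun r hr => ?_
  rw [uIcc_of_le hh] at hr
  rw [max_eq_left hr.1, max_eq_left (add_nonneg hs hr.1), hT.apply_add hr.1 hs]

/-- Integration by parts against the orbit of `∫₀ʰ T(r)x dr`. -/
theorem apply_laplaceCLM_sub (hT : IsSCSemigroup T) {f f' : ℝ → ℝ}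
    (hd : ∀ t ∈ Ici (0 : ℝ), HasDerivWithinAt f (f' t) (Ici 0) t)
    (hf : ContinuousOn f (Ici 0)) (hf' : ContinuousOn f' (Ici 0))
    (hfi : IntegrableOn (fun t => ‖T t‖ * |f t|) (Ioi 0))
    (hfi' : IntegrableOn (fun t => ‖T t‖ * |f' t|) (Ioi 0)) (x : X) {h : ℝ} (hh : 0 ≤ h) :
    T h (hT.laplaceCLM hf hfi x) - hT.laplaceCLM hf hfi x =
      -(hT.laplaceCLM hf' hfi' (∫ r in (0 : ℝ)..h, T (max r 0) x)) -
        f 0 • ∫ r in (0 : ℝ)..h, T (max r 0) x := by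
  set z := ∫ r in (0 : ℝ)..h, T (max r 0) x with hz
  have hcont : ContinuousOn (fun s => f s • T s z) (Ici 0) := hf.smul (hT.2.2 z)
  have hderiv : ∀ s ∈ Ioi (0 : ℝ), HasDerivAt (fun s => f s • T s z)
      (f s • T s (T h x - x) + f' s • T s z) s := by
    intro s (hs : 0 < s)
    have horbit : HasDerivAt (fun s => T s z) (T s (T h x - x)) s := by
      have h2 : HasDerivAt (fun s => (∫ r in (0 : ℝ)..(s + h), T (max r 0) x) -
          ∫ r in (0 : ℝ)..s, T (max r 0) x) (T s (T h x - x)) s := by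
        have := ((hT.hasDerivAt_primitive x (s + h)).comp_add_const s h).sub
          (hT.hasDerivAt_primitive x s)
        rwa [max_eq_left hs.le, max_eq_left (add_nonneg hs.le hh), hT.apply_add hh hs.le,
          ← map_sub] at this
      refine h2.congr_of_eventuallyEq ?_
      filter_upwards [Ioi_mem_nhds hs] with u hu
      exact hT.apply_primitive x hh (le_of_lt hu)
    exact ((hd s hs.le).hasDerivAt (Ici_mem_nhds hs)).smul horbit
  have i1 := hT.integrableOn_smul_s15 hf hfi (T h x - x)
  have i2 := hT.integrableOn_smul_s15 hf' hfi' z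
  have hlim := tendsto_zero_of_hasDerivAt_of_integrableOn_Ioi hderiv (i1.add i2)
    (hT.integrableOn_smul_s15 hf hfi z)
  have key := integral_Ioi_of_hasDerivAt_of_tendsto (hcont 0 self_mem_Ici) hderiv
    (i1.add i2) hlim
  rw [integral_add i1 i2, ← hT.laplaceCLM_apply hf hfi, ← hT.laplaceCLM_apply hf' hfi',
    hT.1, map_sub, ← hT.laplaceCLM_comm hf hfi hh] at key
  rw [eq_sub_of_add_eq key, one_apply_eq_self]
  abel

theorem tendsto_laplaceCLM (hT : IsSCSemigroup T) {f f' : ℝ → ℝ}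
    (hd : ∀ t ∈ Ici (0 : ℝ), HasDerivWithinAt f (f' t) (Ici 0) t)
    (hf : ContinuousOn f (Ici 0)) (hf' : ContinuousOn f' (Ici 0))
    (hfi : IntegrableOn (fun t => ‖T t‖ * |f t|) (Ioi 0))
    (hfi' : IntegrableOn (fun t => ‖T t‖ * |f' t|) (Ioi 0)) (x : X) :
    Tendsto (fun h : ℝ => (1 / h) • (T h (hT.laplaceCLM hf hfi x) - hT.laplaceCLM hf hfi x))
      (nhdsWithin 0 (Ioi 0)) (nhds (-(hT.laplaceCLM hf' hfi' x) - f 0 • x)) := by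
  have hmean : Tendsto (fun h : ℝ => h⁻¹ • ∫ r in (0 : ℝ)..h, T (max r 0) x)
      (nhdsWithin 0 (Ioi 0)) (nhds x) := by
    have := (hT.hasDerivAt_primitive x 0).tendsto_slope_zero_right
    simpa [hT.1] using this
  refine Tendsto.congr' ?_
    ((((hT.laplaceCLM hf' hfi').continuous.tendsto x).comp hmean).neg.sub (hmean.const_smul (f 0)))
  filter_upwards [self_mem_nhdsWithin] with h hh
  rw [hT.apply_laplaceCLM_sub hd hf hf' hfi hfi' x (le_of_lt hh), smul_sub, smul_neg, one_div,
    Function.comp_apply, map_smul, smul_comm (f 0)]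

end IsSCSemigroup

theorem IsGenerator.mem_and_eq {A : X → X} (hA : IsGenerator T A) {x y : X}
    (h : Tendsto (fun h : ℝ => (1 / h) • (T h x - x)) (nhdsWithin 0 (Ioi 0)) (nhds y)) :
    x ∈ genDomain T ∧ A x = y :=
  ⟨⟨y, h⟩, tendsto_nhds_unique (hA x ⟨y, h⟩) h⟩

end Laplace

theorem stmt_15 {X : Type*} [NormedAddCommGroup X] [NormedSpace ℝ X] [CompleteSpace X]
    (T : ℝ → X →L[ℝ] X) (hT : IsSCSemigroup T) (A : X → X) (hA : IsGenerator T A)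
    (g g' g'' : ℝ → ℝ)
    (hderiv : ∀ t ∈ Set.Ici (0 : ℝ), HasDerivWithinAt g (g' t) (Set.Ici 0) t)
    (hderiv' : ∀ t ∈ Set.Ici (0 : ℝ), HasDerivWithinAt g' (g'' t) (Set.Ici 0) t)
    (hg'' : ContinuousOn g'' (Set.Ici 0))
    (hg0 : g 0 = 0) (hg'0 : g' 0 = 1)
    (hint : IntegrableOn (fun t => ‖T t‖ * |g t|) (Set.Ioi 0))
    (hint' : IntegrableOn (fun t => ‖T t‖ * |g' t|) (Set.Ioi 0))
    (hint'' : IntegrableOn (fun t => ‖T t‖ * |g'' t|) (Set.Ioi 0)) :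
    ∀ (a b : ℝ) (x : X),
      (∫ t in Set.Ioi (0 : ℝ), g t • T t x) ∈ iterDomain T A 2 ∧
      A^[2] (∫ t in Set.Ioi (0 : ℝ), g t • T t x) -
          (2 * a) • A (∫ t in Set.Ioi (0 : ℝ), g t • T t x) +
          (a ^ 2 + b ^ 2) • (∫ t in Set.Ioi (0 : ℝ), g t • T t x) =
        x + ∫ t in Set.Ioi (0 : ℝ),
          (g'' t + 2 * a * g' t + (a ^ 2 + b ^ 2) * g t) • T t x := by
  intro a b x
  have hg : ContinuousOn g (Ici 0) := fun t ht => (hderiv t ht).continuousWithinAt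
  have hg' : ContinuousOn g' (Ici 0) := fun t ht => (hderiv' t ht).continuousWithinAt
  have h1 := hT.tendsto_laplaceCLM hderiv hg hg' hint hint' x
  have h2 := (hT.tendsto_laplaceCLM hderiv' hg' hg'' hint' hint'' x).neg
  rw [hg0, zero_smul, sub_zero] at h1
  obtain ⟨m1, e1⟩ := hA.mem_and_eq h1
  obtain ⟨m2, e2⟩ := hA.mem_and_eq (x := -(hT.laplaceCLM hg' hint' x))
    (h2.congr fun h => by rw [map_neg, ← smul_neg]; congr 1; abel)
  have i0 := hT.integrableOn_smul_s15 hg hint x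
  have i1 := hT.integrableOn_smul_s15 hg' hint' x
  have i2 := hT.integrableOn_smul_s15 hg'' hint'' x
  have hsum : (∫ t in Ioi (0 : ℝ), (g'' t + 2 * a * g' t + (a ^ 2 + b ^ 2) * g t) • T t x) =
      hT.laplaceCLM hg'' hint'' x + (2 * a) • hT.laplaceCLM hg' hint' x +
        (a ^ 2 + b ^ 2) • hT.laplaceCLM hg hint x := by
    simp only [add_smul (_ + _) (_ * _), add_smul (g'' _), mul_smul _ (g' _), mul_smul _ (g _)]
    have j1 : IntegrableOn (fun t => (2 * a) • g' t • T t x) (Ioi 0) := i1.smul _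
    have j0 : IntegrableOn (fun t => (a ^ 2 + b ^ 2) • g t • T t x) (Ioi 0) := i0.smul _
    have j2 : IntegrableOn (fun t => g'' t • T t x + (2 * a) • g' t • T t x) (Ioi 0) := i2.add j1
    rw [integral_add j2 j0, integral_add i2 j1, integral_smul, integral_smul]
    rfl
  rw [hsum, ← hT.laplaceCLM_apply hg hint]
  refine ⟨⟨⟨mem_univ _, m1⟩, ?_⟩, ?_⟩
  · simpa only [Function.iterate_one, e1] using m2
  · simp only [Function.iterate_succ, Function.iterate_zero, Function.comp_apply, id, e1, e2, hg'0]
    module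
end
end
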